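/- arXiv:1010.0590 — 2 statements merged into one kernel-verified Lean document; each statement's English description precedes it below -/
import Mathlib

section
/- Let X be a Hadamard space, x ∈ X, and let (μ_t), (σ_t) be two unit-speed geodesics (possibly rays) in W₂(X) both starting at the Dirac mass δ_x. Then for nonnegative s, t, the Euclidean comparison angle at δ_x of the triangle (δ_x, μ_s, σ_t) — the angle at the x̃-vertex of a Euclidean triangle with side lengths W(δ_x,μ_s), W(δ_x,σ_t), W(μ_s,σ_t) — is a nondecreasing function of s and of t. Consequently, the map t ↦ W(μ_t, σ_t)/t is nondecreasing. -/
open MeasureTheory Filter Set Topology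
open scoped NNReal ENNReal

noncomputable section


/-! ## Geodesics and Hadamard spaces -/

/-- `γ` is a geodesic on the set of parameters `s`, of speed `v`, with respect to the
distance function `d`. -/
def IsGeodesicOnWith {A : Type*} (d : A → A → ℝ) (γ : ℝ → A) (s : Set ℝ) (v : ℝ) : Prop :=
  ∀ t ∈ s, ∀ t' ∈ s, d (γ t) (γ t') = v * |t - t'|

/-- A metric space is geodesic if any two points are joined by a geodesic. -/
def IsGeodesicSpace (Y : Type*) [MetricSpace Y] : Prop :=
  ∀ x y : Y, ∃ γ : ℝ → Y, γ 0 = x ∧ γ 1 = y ∧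
    IsGeodesicOnWith dist γ (Set.Icc (0:ℝ) 1) (dist x y)

/-- Every geodesic segment extends to a complete geodesic (defined on all of `ℝ`). -/
def GeodesicallyComplete (Y : Type*) [MetricSpace Y] : Prop :=
  ∀ (γ : ℝ → Y) (a b v : ℝ), a < b → IsGeodesicOnWith dist γ (Set.Icc a b) v →
    ∃ g : ℝ → Y, IsGeodesicOnWith dist g Set.univ v ∧ ∀ t ∈ Set.Icc a b, g t = γ t

/-- A Hadamard space: complete, separable, locally compact, geodesic, globally CAT(0).
The CAT(0) comparison inequality is expressed through the explicit formula for the distance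
from a vertex to a point of the opposite side in the Euclidean comparison triangle. -/
structure IsHadamard (X : Type*) [MetricSpace X] : Prop where
  complete : CompleteSpace X
  separable : TopologicalSpace.SeparableSpace X
  locallyCompact : LocallyCompactSpace X
  geodesic : IsGeodesicSpace X
  cat0 : ∀ (x y z : X) (γ : ℝ → X), γ 0 = y → γ 1 = z →
    IsGeodesicOnWith dist γ (Set.Icc (0:ℝ) 1) (dist y z) →
    ∀ t ∈ Set.Icc (0:ℝ) 1,
      dist x (γ t) ^ 2 ≤ (1 - t) * dist x y ^ 2 + t * dist x z ^ 2 - t * (1 - t) * dist y z ^ 2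

/-- A space is non-branching if two geodesics coinciding on a nonempty open set of parameters
coincide on their whole common interval of definition. -/
def NonBranching (X : Type*) [MetricSpace X] : Prop :=
  ∀ (γ β : ℝ → X) (I : Set ℝ) (v w : ℝ),
    IsGeodesicOnWith dist γ I v → IsGeodesicOnWith dist β I w →
    (∃ U : Set ℝ, U ⊆ I ∧ IsOpen U ∧ U.Nonempty ∧ ∀ t ∈ U, γ t = β t) →
    ∀ t ∈ I, γ t = β t

/-! ## The Wasserstein space -/

/-- `π` is a coupling (transport plan) between `μ` and `ν`. -/
def IsCoupling {A B : Type*} [MeasurableSpace A] [MeasurableSpace B]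
    (π : Measure (A × B)) (μ : Measure A) (ν : Measure B) : Prop :=
  π.map Prod.fst = μ ∧ π.map Prod.snd = ν

/-- The quadratic Wasserstein space over `Y`: Borel probability measures with finite second
moment. -/
abbrev W2Space (Y : Type*) [MetricSpace Y] [MeasurableSpace Y] : Type _ :=
  {μ : Measure Y // IsProbabilityMeasure μ ∧
    ∃ x₀ : Y, (∫⁻ x, ENNReal.ofReal (dist x₀ x) ^ 2 ∂μ) < ⊤}

/-- The quadratic transport cost between two measures. -/
def W2cost {Y : Type*} [MetricSpace Y] [MeasurableSpace Y] (μ ν : Measure Y) : ℝ≥0∞ :=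
  ⨅ (π : Measure (Y × Y)) (_ : IsCoupling π μ ν),
    ∫⁻ p, ENNReal.ofReal (dist p.1 p.2) ^ 2 ∂π

/-- The quadratic Wasserstein distance. -/
def Wdist {Y : Type*} [MetricSpace Y] [MeasurableSpace Y] (μ ν : W2Space Y) : ℝ :=
  Real.sqrt (W2cost μ.1 ν.1).toReal


/-! ## Rays, complete geodesics, the boundary at infinity and the cone over it -/

/-- Geodesic rays of `X` (arbitrary nonnegative speed), parametrized by `ℝ≥0`.
The topology (of a subtype of a product) coincides on this set with the topology of
uniform convergence on compact sets. -/
abbrev RaySpace (X : Type*) [MetricSpace X] : Type _ :=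
  {γ : ℝ≥0 → X // ∃ v : ℝ, 0 ≤ v ∧ ∀ s t : ℝ≥0, dist (γ s) (γ t) = v * dist s t}

/-- Unit speed geodesic rays of `X`. -/
abbrev UnitRay (X : Type*) [MetricSpace X] : Type _ :=
  {γ : ℝ≥0 → X // ∀ s t : ℝ≥0, dist (γ s) (γ t) = dist s t}

/-- Complete geodesics of `X` (arbitrary nonnegative speed). -/
abbrev GeoLine (X : Type*) [MetricSpace X] : Type _ :=
  {γ : ℝ → X // ∃ v : ℝ, 0 ≤ v ∧ ∀ s t : ℝ, dist (γ s) (γ t) = v * |s - t|}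

/-- Complete unit speed geodesics of `X`. -/
abbrev UnitLine (X : Type*) [MetricSpace X] : Type _ :=
  {γ : ℝ → X // ∀ s t : ℝ, dist (γ s) (γ t) = |s - t|}

/-- Evaluation of a ray at time `t`. -/
def rayEval {X : Type*} [MetricSpace X] (t : ℝ≥0) : RaySpace X → X := fun γ => γ.1 t

/-- Two curves (w.r.t. a distance function `d`) are asymptotic if they stay at bounded
distance. -/
def AsymptoticMaps {A : Type*} (d : A → A → ℝ) (γ β : ℝ≥0 → A) : Prop :=
  ∃ C : ℝ, ∀ t, d (γ t) (β t) ≤ C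

/-- The asymptote relation on unit-speed rays. -/
def unitRaySetoid (X : Type*) [MetricSpace X] : Setoid (UnitRay X) where
  r γ β := AsymptoticMaps dist γ.1 β.1
  iseqv := by
    refine ⟨fun γ => ⟨0, fun t => by simp⟩, ?_, ?_⟩
    · rintro γ β ⟨C, h⟩
      exact ⟨C, fun t => by rw [dist_comm]; exact h t⟩
    · rintro γ β δ ⟨C, h⟩ ⟨C', h'⟩
      exact ⟨C + C', fun t => (dist_triangle _ _ _).trans (add_le_add (h t) (h' t))⟩

/-- The geodesic boundary of `X`: asymptote classes of unit-speed rays, with the quotient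
topology of the topology of uniform convergence on compact sets (the cone topology). -/
abbrev Boundary (X : Type*) [MetricSpace X] := Quotient (unitRaySetoid X)

/-- Apex-like points, to be collapsed when forming the cone over `B`. -/
def coneIsApex {B : Type*} : B × ℝ≥0 ⊕ Unit → Prop
  | Sum.inl p => p.2 = 0
  | Sum.inr _ => True

/-- The relation collapsing all apex-like points. -/
def coneSetoid (B : Type*) : Setoid (B × ℝ≥0 ⊕ Unit) where
  r p q := p = q ∨ (coneIsApex p ∧ coneIsApex q)
  iseqv := by
    refine ⟨fun p => Or.inl rfl, ?_, ?_⟩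
    · rintro p q (rfl | h)
      · exact Or.inl rfl
      · exact Or.inr ⟨h.2, h.1⟩
    · rintro p q r (rfl | h) (rfl | h')
      · exact Or.inl rfl
      · exact Or.inr h'
      · exact Or.inr h
      · exact Or.inr ⟨h.1, h'.2⟩

/-- The cone over a space `B`: the quotient of `B × [0,∞)` collapsing the zero level to the
apex, with the quotient topology. -/
abbrev Cone (B : Type*) := Quotient (coneSetoid B)

/-- The point of the cone over `b` at height (speed) `s`. -/
def coneMk {B : Type*} (b : B) (s : ℝ≥0) : Cone B :=
  Quotient.mk (coneSetoid B) (Sum.inl (b, s))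

/-- The apex of the cone. -/
def conePt (B : Type*) : Cone B := Quotient.mk (coneSetoid B) (Sum.inr ())

private def coneSpeedAux {B : Type*} : B × ℝ≥0 ⊕ Unit → ℝ≥0
  | Sum.inl p => p.2
  | Sum.inr _ => 0

/-- The speed (radial) coordinate of a point of the cone. -/
def coneSpeed {B : Type*} : Cone B → ℝ≥0 :=
  Quotient.lift coneSpeedAux (by
    rintro p q (rfl | ⟨h1, h2⟩)
    · rfl
    · cases p <;> cases q <;> simp_all [coneIsApex, coneSpeedAux])

/-- The speed of a geodesic ray. -/
def raySpeed {X : Type*} [MetricSpace X] (γ : RaySpace X) : ℝ≥0 :=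
  nndist (γ.1 0) (γ.1 1)

lemma raySpeed_eq {X : Type*} [MetricSpace X] (γ : RaySpace X) {v : ℝ} (hv0 : 0 ≤ v)
    (hv : ∀ s t : ℝ≥0, dist (γ.1 s) (γ.1 t) = v * dist s t) : (raySpeed γ : ℝ) = v := by
  have h1 := hv 0 1
  have h2 : dist (0 : ℝ≥0) (1 : ℝ≥0) = 1 := by rw [NNReal.dist_eq]; norm_num
  rw [h2, mul_one] at h1
  rw [show (raySpeed γ : ℝ) = dist (γ.1 0) (γ.1 1) from (dist_nndist _ _).symm, h1]

/-- The unit reparametrization of a nonconstant ray. -/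
def rayUnit {X : Type*} [MetricSpace X] (γ : RaySpace X) (h : raySpeed γ ≠ 0) : UnitRay X := by
  refine ⟨fun t => γ.1 (t / raySpeed γ), ?_⟩
  obtain ⟨v, hv0, hv⟩ := γ.2
  have hveq : (raySpeed γ : ℝ) = v := raySpeed_eq γ hv0 hv
  intro s t
  have hr : (raySpeed γ : ℝ) ≠ 0 := by
    simpa using h
  show dist (γ.1 (s / raySpeed γ)) (γ.1 (t / raySpeed γ)) = dist s t
  rw [hv, NNReal.dist_eq, NNReal.dist_eq, NNReal.coe_div, NNReal.coe_div,
    div_sub_div_same, abs_div, abs_of_nonneg (raySpeed γ).coe_nonneg, ← hveq]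
  field_simp

/-- The point at infinity (in the cone over the boundary) defined by a geodesic ray:
its asymptote class together with its speed; constant rays are sent to the apex. -/
def rayEnd {X : Type*} [MetricSpace X] (γ : RaySpace X) : Cone (Boundary X) :=
  if h : raySpeed γ = 0 then conePt (Boundary X)
  else coneMk (Quotient.mk (unitRaySetoid X) (rayUnit γ h)) (raySpeed γ)

/-! ## Asymptotic distance -/

def dInfty {X : Type*} [MetricSpace X] (γ β : ℝ≥0 → X) : ℝ :=
  Filter.limsup (fun t : ℝ≥0 => dist (γ t) (β t) / (t : ℝ)) Filter.atTop

/-- The asymptotic (angular) distance on the boundary, computed on representative rays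
(it does not depend on the choice of representatives). -/
def boundaryDist {X : Type*} [MetricSpace X] (ξ ζ : Boundary X) : ℝ :=
  dInfty (ξ.out).1 (ζ.out).1

def coneDistAux {X : Type*} [MetricSpace X] :
    Boundary X × ℝ≥0 ⊕ Unit → Boundary X × ℝ≥0 ⊕ Unit → ℝ
  | Sum.inl p, Sum.inl q =>
      Real.sqrt (((p.2 : ℝ) - (q.2 : ℝ)) ^ 2 + (p.2 : ℝ) * (q.2 : ℝ) * boundaryDist p.1 q.1 ^ 2)
  | Sum.inl p, Sum.inr _ => p.2
  | Sum.inr _, Sum.inl q => q.2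
  | Sum.inr _, Sum.inr _ => 0

/-- The asymptotic distance on the cone over the boundary (the cone metric). -/
def coneDist {X : Type*} [MetricSpace X] : Cone (Boundary X) → Cone (Boundary X) → ℝ :=
  Quotient.lift₂ coneDistAux (by
    rintro a₁ a₂ b₁ b₂ h12 h34
    rcases h12 with rfl | ⟨h1, h2⟩ <;> rcases h34 with rfl | ⟨h3, h4⟩
    · rfl
    · rcases a₁ with p | u <;> rcases a₂ with q | v <;> rcases b₂ with q' | w <;>
        simp_all [coneIsApex, coneDistAux, Real.sqrt_sq, NNReal.coe_nonneg]
    · rcases a₂ with q | u <;> rcases a₁ with p | v <;> rcases b₁ with p' | w <;>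
        simp_all [coneIsApex, coneDistAux, Real.sqrt_sq, NNReal.coe_nonneg]
    · rcases a₁ with p | u <;> rcases a₂ with q | v <;> rcases b₁ with p' | w <;>
        rcases b₂ with q' | w' <;>
        simp_all [coneIsApex, coneDistAux, Real.sqrt_sq, NNReal.coe_nonneg])


-- Borel measurable structure on the boundary and the cone over it.
instance (X : Type*) [MetricSpace X] : MeasurableSpace (Boundary X) := borel _
instance (X : Type*) [MetricSpace X] : BorelSpace (Boundary X) := ⟨rfl⟩
instance (X : Type*) [MetricSpace X] : MeasurableSpace (Cone (Boundary X)) := borel _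
instance (X : Type*) [MetricSpace X] : BorelSpace (Cone (Boundary X)) := ⟨rfl⟩

/-- The Wasserstein metric `W_∞` on measures on the cone over the boundary, built from the
cost `d_∞²`. -/
def Winfty {X : Type*} [MetricSpace X] (m m' : Measure (Cone (Boundary X))) : ℝ :=
  Real.sqrt (⨅ (π : Measure (Cone (Boundary X) × Cone (Boundary X)))
    (_ : IsCoupling π m m'),
      ∫⁻ p, ENNReal.ofReal (coneDist p.1 p.2) ^ 2 ∂π).toReal


/-! ## Visibility -/

/-- `X` is a visibility space: any two distinct boundary points are the two endpoints of a
complete geodesic. -/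
def IsVisibility (X : Type*) [MetricSpace X] : Prop :=
  ∀ α ω : UnitRay X, ¬ AsymptoticMaps dist α.1 ω.1 →
    ∃ g : ℝ → X, (∀ s t : ℝ, dist (g s) (g t) = |s - t|) ∧
      AsymptoticMaps dist (fun t : ℝ≥0 => g (-(t : ℝ))) α.1 ∧
      AsymptoticMaps dist (fun t : ℝ≥0 => g (t : ℝ)) ω.1

/-! ## Curves, length, rectifiability -/

/-- The length of a curve with respect to a distance function `d`, as a supremum over
finite monotone sequences of parameters in `[a,b]`. -/
def curveLengthWith {A : Type*} (d : A → A → ℝ) (c : ℝ → A) (a b : ℝ) : ℝ≥0∞ :=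
  ⨆ (n : ℕ) (t : Fin (n + 1) → ℝ) (_ : Monotone t) (_ : ∀ i, t i ∈ Set.Icc a b),
    ∑ i : Fin n, ENNReal.ofReal (d (c (t i.castSucc)) (c (t i.succ)))

/-- Continuity of a curve with respect to a distance function `d`, on a set of parameters. -/
def ContinuousWithRespect {A : Type*} (d : A → A → ℝ) (c : ℝ → A) (s : Set ℝ) : Prop :=
  ∀ t ∈ s, ∀ ε : ℝ, 0 < ε → ∃ δ : ℝ, 0 < δ ∧ ∀ u ∈ s, |u - t| < δ → d (c u) (c t) < ε

/-- `W_∞` between measures on the boundary, viewed as the level `{speed = 1}` of the cone,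
with cost `d_∞²`. -/
def WinftyLevel1 {X : Type*} [MetricSpace X] (m m' : Measure (Boundary X)) : ℝ :=
  Real.sqrt (⨅ (π : Measure (Boundary X × Boundary X)) (_ : IsCoupling π m m'),
    ∫⁻ p, ENNReal.ofReal (coneDist (coneMk p.1 1) (coneMk p.2 1)) ^ 2 ∂π).toReal

/-! ## Support of a measure -/

/-- The (topological) support of a measure. -/
def msupport {A : Type*} [TopologicalSpace A] [MeasurableSpace A] (μ : Measure A) : Set A :=
  {x | ∀ U : Set A, x ∈ U → IsOpen U → 0 < μ U}

/-! ## Cyclical monotonicity and antagonism -/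

/-- A set `Γ` is `c`-cyclically monotone if no cyclic permutation of the target points of a
finite family of pairs of `Γ` decreases the total cost. -/
def CyclicallyMonotone {A : Type*} (c : A → A → ℝ) (Γ : Set (A × A)) : Prop :=
  ∀ (m : ℕ) (p : Fin (m + 1) → A × A), (∀ i, p i ∈ Γ) →
    (∑ i, c (p i).1 (p i).2) ≤ ∑ i, c (p i).1 (p (i + 1)).2

/-- Two curves are antagonist if they pass through two distinct points in opposite orders. -/
def Antagonist {X : Type*} (γ β : ℝ → X) : Prop :=
  ∃ x y : X, x ≠ y ∧ (∃ s t : ℝ, s < t ∧ γ s = x ∧ γ t = y) ∧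
    (∃ s t : ℝ, s < t ∧ β s = y ∧ β t = x)

/-! ## Negative curvature, trees -/

/-- Three points lying on a common geodesic. -/
def Aligned {X : Type*} [MetricSpace X] (x y z : X) : Prop :=
  dist x y + dist y z = dist x z ∨ dist y x + dist x z = dist y z ∨
    dist x z + dist z y = dist x y

/-- `X` is negatively curved: it is not a line, and the CAT(0) comparison inequality is
strict except for aligned triangles. -/
def IsNegativelyCurved (X : Type*) [MetricSpace X] : Prop :=
  (¬ ∃ f : ℝ → X, Function.Surjective f ∧ ∀ s t : ℝ, dist (f s) (f t) = |s - t|) ∧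
  ∀ (x y z : X) (γ : ℝ → X), γ 0 = y → γ 1 = z →
    IsGeodesicOnWith dist γ (Set.Icc (0:ℝ) 1) (dist y z) → ¬ Aligned x y z →
    ∀ t ∈ Set.Ioo (0:ℝ) 1,
      dist x (γ t) ^ 2 < (1 - t) * dist x y ^ 2 + t * dist x z ^ 2 - t * (1 - t) * dist y z ^ 2

/-- A metric tree (real tree): a geodesic space satisfying the four-point 0-hyperbolicity
condition. -/
def IsRealTree (X : Type*) [MetricSpace X] : Prop :=
  IsGeodesicSpace X ∧ ∀ x y z w : X,
    dist x y + dist z w ≤ max (dist x z + dist y w) (dist x w + dist y z)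

/-! ## Ends of complete geodesics -/

/-- The forward ray of a complete geodesic. -/
def lineForward {X : Type*} [MetricSpace X] (γ : GeoLine X) : RaySpace X :=
  ⟨fun t : ℝ≥0 => γ.1 (t : ℝ), by
    obtain ⟨v, hv0, hv⟩ := γ.2
    exact ⟨v, hv0, fun s t => by rw [hv, NNReal.dist_eq]⟩⟩

/-- The backward ray of a complete geodesic. -/
def lineBackward {X : Type*} [MetricSpace X] (γ : GeoLine X) : RaySpace X :=
  ⟨fun t : ℝ≥0 => γ.1 (-(t : ℝ)), by
    obtain ⟨v, hv0, hv⟩ := γ.2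
    refine ⟨v, hv0, fun s t => ?_⟩
    rw [hv, NNReal.dist_eq]
    congr 1
    rw [abs_sub_comm]
    congr 1
    ring⟩

/-- The end at `+∞` of a complete geodesic, in the cone over the boundary. -/
def lineEndPlus {X : Type*} [MetricSpace X] (γ : GeoLine X) : Cone (Boundary X) :=
  rayEnd (lineForward γ)

/-- The end at `-∞` of a complete geodesic, in the cone over the boundary. -/
def lineEndMinus {X : Type*} [MetricSpace X] (γ : GeoLine X) : Cone (Boundary X) :=
  rayEnd (lineBackward γ)

/-- `g` is a unit complete geodesic with ends `ξ` (at `-∞`) and `ζ` (at `+∞`). -/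
def LineConnects {X : Type*} [MetricSpace X] (g : ℝ → X) (ξ ζ : Boundary X) : Prop :=
  (∀ s t : ℝ, dist (g s) (g t) = |s - t|) ∧
  (∃ γ : UnitRay X, Quotient.mk (unitRaySetoid X) γ = ξ ∧
    AsymptoticMaps dist (fun u : ℝ≥0 => g (-(u : ℝ))) γ.1) ∧
  (∃ γ : UnitRay X, Quotient.mk (unitRaySetoid X) γ = ζ ∧
    AsymptoticMaps dist (fun u : ℝ≥0 => g (u : ℝ)) γ.1)

/-- Two boundary points are antipodal if they are joined by a complete geodesic. -/
def Antipodal {X : Type*} [MetricSpace X] (ξ ζ : Boundary X) : Prop :=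
  ∃ g : ℝ → X, LineConnects g ξ ζ

/-- Two measures on the boundary are antipodal if they are concentrated on antipodal sets. -/
def AntipodalMeasures {X : Type*} [MetricSpace X] (νm νp : Measure (Boundary X)) : Prop :=
  ∃ A B : Set (Boundary X), MeasurableSet A ∧ MeasurableSet B ∧ νm A = 1 ∧ νp B = 1 ∧
    ∀ ξ ∈ A, ∀ ζ ∈ B, Antipodal ξ ζ

/-- Two measures on the boundary are uniformly antipodal if their supports are antipodal. -/
def UniformlyAntipodal {X : Type*} [MetricSpace X] (νm νp : Measure (Boundary X)) : Prop :=
  ∀ ξ ∈ msupport νm, ∀ ζ ∈ msupport νp, Antipodal ξ ζ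

/-- The distance from the base point `x₀` to the geodesic line joining two boundary points
(for trees, the Gromov product). -/
def D0 {X : Type*} [MetricSpace X] (x₀ : X) (ξ ζ : Boundary X) : ℝ :=
  sInf {r : ℝ | ∃ g : ℝ → X, LineConnects g ξ ζ ∧ ∃ t : ℝ, r = dist x₀ (g t)}

/-- The unit geodesic from `ξ` to `ζ`, parametrized so that its time-`0` point is closest to
the base point `x₀`. -/
def lineFrom {X : Type*} [MetricSpace X] (x₀ : X) (ξ ζ : Boundary X) : ℝ → X :=
  haveI : Nonempty X := ⟨x₀⟩
  Classical.epsilon fun g : ℝ → X =>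
    LineConnects g ξ ζ ∧ dist x₀ (g 0) = D0 x₀ ξ ζ

/-! ## Flows on trees -/

/-- The set of boundary points whose rays eventually lie in `C`. -/
def compBdry {X : Type*} [MetricSpace X] (C : Set X) : Set (Boundary X) :=
  {ξ | ∀ γ : UnitRay X, Quotient.mk (unitRaySetoid X) γ = ξ →
    ∃ T : ℝ≥0, ∀ t : ℝ≥0, T ≤ t → γ.1 t ∈ C}

/-- The connected components of the complement of a point. -/
def treeComps {X : Type*} [TopologicalSpace X] (x : X) : Set (Set X) :=
  {C | ∃ y : X, y ≠ x ∧ C = connectedComponentIn {x}ᶜ y}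

/-- A vertex (branch point) of a tree: the complement has at least three components. -/
def IsTreeVertex {X : Type*} [TopologicalSpace X] (x : X) : Prop :=
  ∃ C₁ C₂ C₃ : Set X, C₁ ∈ treeComps x ∧ C₂ ∈ treeComps x ∧ C₃ ∈ treeComps x ∧
    C₁ ≠ C₂ ∧ C₂ ≠ C₃ ∧ C₁ ≠ C₃

/-- The value of the signed measure `ν₊ - ν₋` on a set of boundary points. -/
def sflow {X : Type*} [MetricSpace X] (νm νp : Measure (Boundary X))
    (S : Set (Boundary X)) : ℝ :=
  (νp S).toReal - (νm S).toReal

/-- The boundary directions at `x` carrying positive flow. -/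
def posBdrySet {X : Type*} [MetricSpace X] (νm νp : Measure (Boundary X)) (x : X) :
    Set (Boundary X) :=
  ⋃ (C : Set X) (_ : C ∈ treeComps x) (_ : 0 < sflow νm νp (compBdry C)), compBdry C

/-- The boundary directions at `x` carrying negative flow. -/
def negBdrySet {X : Type*} [MetricSpace X] (νm νp : Measure (Boundary X)) (x : X) :
    Set (Boundary X) :=
  ⋃ (C : Set X) (_ : C ∈ treeComps x) (_ : sflow νm νp (compBdry C) < 0), compBdry C

/-- The flow through the point `x`. -/
def flowAt {X : Type*} [MetricSpace X] (νm νp : Measure (Boundary X)) (x : X) : ℝ :=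
  sflow νm νp (posBdrySet νm νp x)

open Classical in
/-- The specific flow through `x`: the flow through `x`, not counting the edge pointing
towards the base point `x₀` when the latter is positive (resp. negative). -/
def specificFlow {X : Type*} [MetricSpace X] (νm νp : Measure (Boundary X))
    (x₀ x : X) : ℝ :=
  if x = x₀ then flowAt νm νp x
  else if 0 < sflow νm νp (compBdry (connectedComponentIn {x}ᶜ x₀)) then
    sflow νm νp (posBdrySet νm νp x \ compBdry (connectedComponentIn {x}ᶜ x₀))
  else if sflow νm νp (compBdry (connectedComponentIn {x}ᶜ x₀)) < 0 then
    - sflow νm νp (negBdrySet νm νp x \ compBdry (connectedComponentIn {x}ᶜ x₀))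
  else flowAt νm νp x

/-- The pair `(ν₋, ν₊)` is realized as the pair of ends of a complete unit-speed geodesic of
the Wasserstein space, through a displacement interpolation `m`. -/
def RealizableEnds {X : Type*} [MetricSpace X] [MeasurableSpace X]
    (νm νp : Measure (Boundary X)) : Prop :=
  ∃ (μt : ℝ → W2Space X) (m : Measure (GeoLine X)), IsProbabilityMeasure m ∧
    (∀ s t : ℝ, Wdist (μt s) (μt t) = |s - t|) ∧
    (∀ t : ℝ, m.map (fun γ : GeoLine X => γ.1 t) = (μt t).1) ∧
    m.map lineEndMinus = νm.map (fun ξ : Boundary X => coneMk ξ 1) ∧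
    m.map lineEndPlus = νp.map (fun ξ : Boundary X => coneMk ξ 1)

/-- The cost `∫ D₀² dπ` of a transport plan (the optimal transport problem for the cost
`-D₀²` is finite iff the supremum of this quantity over all couplings is finite, and its
minimizers are the maximizers of this quantity). -/
def D0cost {X : Type*} [MetricSpace X] (x₀ : X)
    (π : Measure (Boundary X × Boundary X)) : ℝ≥0∞ :=
  ∫⁻ p, ENNReal.ofReal (D0 x₀ p.1 p.2) ^ 2 ∂π

/-- The supremum of `∫ D₀² dπ` over couplings of `(ν₋, ν₊)`. -/
def D0supCost {X : Type*} [MetricSpace X] (x₀ : X) (νm νp : Measure (Boundary X)) : ℝ≥0∞ :=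
  ⨆ (π : Measure (Boundary X × Boundary X)) (_ : IsCoupling π νm νp), D0cost x₀ π

/-! ## The geodesic boundary of the Wasserstein space -/

/-- The metric topology of the Wasserstein distance. -/
instance (Y : Type*) [MetricSpace Y] [MeasurableSpace Y] : TopologicalSpace (W2Space Y) :=
  TopologicalSpace.generateFrom
    {S | ∃ (μ : W2Space Y) (ε : ℝ), S = {ν : W2Space Y | Wdist μ ν < ε}}

/-- Unit-speed geodesic rays of the Wasserstein space. -/
abbrev W2UnitRay (X : Type*) [MetricSpace X] [MeasurableSpace X] : Type _ :=
  {f : ℝ≥0 → W2Space X // ∀ s t : ℝ≥0, Wdist (f s) (f t) = dist s t}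

/-- Probability measures on the cone over the boundary with `∫ v² dν = 1`, with the weak
topology. -/
abbrev P1Cone (X : Type*) [MetricSpace X] : Type _ :=
  {ν : ProbabilityMeasure (Cone (Boundary X)) //
    ∫⁻ c, (coneSpeed c : ℝ≥0∞) ^ 2 ∂(ν : Measure (Cone (Boundary X))) = 1}

/-- Probability measures (as plain measures) on the cone over the boundary with
`∫ v² dν = 1`. -/
abbrev P1ConeM (X : Type*) [MetricSpace X] : Type _ :=
  {ν : Measure (Cone (Boundary X)) // IsProbabilityMeasure ν ∧
    ∫⁻ c, (coneSpeed c : ℝ≥0∞) ^ 2 ∂ν = 1}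


/-! ## Locally Riemannian points -/

/-- The Riemannian length of a path `γ : [0,1] → ℝⁿ` for the metric tensor `g`. -/
def riemannianPathLength {n : ℕ}
    (g : EuclideanSpace ℝ (Fin n) → EuclideanSpace ℝ (Fin n) →L[ℝ] EuclideanSpace ℝ (Fin n))
    (γ : ℝ → EuclideanSpace ℝ (Fin n)) : ℝ :=
  ∫ t in (0:ℝ)..1, Real.sqrt (@inner ℝ _ _ (g (γ t) (deriv γ t)) (deriv γ t))

/-- The Riemannian distance in `U ⊆ ℝⁿ` for the metric tensor `g`: the infimum of
Riemannian lengths of `C¹` paths in `U` joining the two points. -/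
def riemannianDist {n : ℕ} (U : Set (EuclideanSpace ℝ (Fin n)))
    (g : EuclideanSpace ℝ (Fin n) → EuclideanSpace ℝ (Fin n) →L[ℝ] EuclideanSpace ℝ (Fin n))
    (p q : EuclideanSpace ℝ (Fin n)) : ℝ :=
  sInf {L : ℝ | ∃ γ : ℝ → EuclideanSpace ℝ (Fin n), ContDiffOn ℝ 1 γ (Set.Icc (0:ℝ) 1) ∧
    (∀ t ∈ Set.Icc (0:ℝ) 1, γ t ∈ U) ∧ γ 0 = p ∧ γ 1 = q ∧ L = riemannianPathLength g γ}

/-- `x` admits a neighborhood isometric to an open subset of a Riemannian manifold of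
dimension at least 2 (expressed in a chart: an open subset of `ℝⁿ`, `n ≥ 2`, equipped with
the distance induced by a smooth positive-definite symmetric metric tensor). -/
def IsLocallyRiemannian (X : Type*) [MetricSpace X] (x : X) : Prop :=
  ∃ n : ℕ, 2 ≤ n ∧
  ∃ (U : Set (EuclideanSpace ℝ (Fin n)))
    (g : EuclideanSpace ℝ (Fin n) → EuclideanSpace ℝ (Fin n) →L[ℝ] EuclideanSpace ℝ (Fin n))
    (V : Set X) (φ : X → EuclideanSpace ℝ (Fin n)),
    IsOpen U ∧ ContDiffOn ℝ (⊤ : ℕ∞) g U ∧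
    (∀ p ∈ U, ∀ v w : EuclideanSpace ℝ (Fin n),
      @inner ℝ _ _ (g p v) w = @inner ℝ _ _ v (g p w)) ∧
    (∀ p ∈ U, ∀ v : EuclideanSpace ℝ (Fin n), v ≠ 0 → 0 < @inner ℝ _ _ (g p v) v) ∧
    V ∈ nhds x ∧ Set.BijOn φ V U ∧
    ∀ a ∈ V, ∀ b ∈ V, dist a b = riemannianDist U g (φ a) (φ b)

/-! ## The combinatorial perpendicular Radon transform on a tree -/

/-- `y` and `z` lie in the same connected component of the graph `G` minus the vertex `x`. -/
def sameComp {V : Type*} (G : SimpleGraph V) (x y z : V) : Prop :=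
  ∃ (hy : y ≠ x) (hz : z ≠ x), (G.induce {w : V | w ≠ x}).Reachable ⟨y, hy⟩ ⟨z, hz⟩

/-- The perpendicular `⊥ˣ(ef)` of a flag: the union of `{x}` and of the components of
`G - x` containing none of the vertices of `p` (for a flag, `p = {e, f}` is a pair of
neighbors of `x`). -/
def perpSet {V : Type*} (G : SimpleGraph V) (x : V) (p : Finset V) : Set V :=
  {x} ∪ {y | ∀ e ∈ p, ¬ sameComp G x y e}

/-- The combinatorial perpendicular Radon transform of a summable function `h` on the
vertices, evaluated on a flag `(x, p)`. -/
def perpRadon {V : Type*} (G : SimpleGraph V) (h : V → ℝ) (x : V) (p : Finset V) : ℝ :=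
  ∑' y : perpSet G x p, h y


section WassersteinComparison

variable {X : Type*} [MetricSpace X]

/-- In a Hadamard space, the point `h y` at fraction `l` of the segment from `x` to `y`
satisfies the CAT(0) inequality. -/
lemma IsHadamard.exists_homothety (hX : IsHadamard X) (x : X) {l : ℝ} (hl : l ∈ Set.Icc (0:ℝ) 1) :
    ∃ h : X → X, ∀ y w, dist w (h y) ^ 2 ≤
      (1 - l) * dist w x ^ 2 + l * dist w y ^ 2 - l * (1 - l) * dist x y ^ 2 := by
  choose γ h0 h1 hγ using fun y => hX.geodesic x y
  exact ⟨fun y => γ y l, fun y w => hX.cat0 w x y (γ y) (h0 y) (h1 y) (hγ y) l hl⟩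

lemma dist_homothety_homothety_sq_le {x : X} {l k : ℝ} (hk : k ∈ Set.Icc (0:ℝ) 1)
    {h g : X → X}
    (hh : ∀ y w, dist w (h y) ^ 2 ≤
      (1 - l) * dist w x ^ 2 + l * dist w y ^ 2 - l * (1 - l) * dist x y ^ 2)
    (hg : ∀ y w, dist w (g y) ^ 2 ≤
      (1 - k) * dist w x ^ 2 + k * dist w y ^ 2 - k * (1 - k) * dist x y ^ 2) (y z : X) :
    dist (h y) (g z) ^ 2 ≤
      (l ^ 2 - l * k) * dist x y ^ 2 + (k ^ 2 - l * k) * dist x z ^ 2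
        + l * k * dist y z ^ 2 := by
  have h1 := hg z (h y)
  have h2 := hh y x
  have h3 := hh y z
  rw [dist_comm (h y) x, dist_comm (h y) z] at h1
  rw [dist_self] at h2
  rw [dist_comm z x, dist_comm z y] at h3
  have h4 := mul_le_mul_of_nonneg_left h2 (sub_nonneg.2 hk.2)
  have h5 := mul_le_mul_of_nonneg_left h3 hk.1
  nlinarith

lemma continuous_homothety {x : X} {l : ℝ} (hl : l ∈ Set.Icc (0:ℝ) 1) {h : X → X}
    (hh : ∀ y w, dist w (h y) ^ 2 ≤
      (1 - l) * dist w x ^ 2 + l * dist w y ^ 2 - l * (1 - l) * dist x y ^ 2) :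
    Continuous h := by
  refine (LipschitzWith.of_dist_le_mul (K := 1) fun y z => ?_).continuous
  have h1 := dist_homothety_homothety_sq_le hl hh hh y z
  have h2 : l ^ 2 * dist y z ^ 2 ≤ 1 * dist y z ^ 2 := by
    gcongr
    exact pow_le_one₀ hl.1 hl.2
  rw [NNReal.coe_one, one_mul]
  exact abs_le_of_sq_le_sq' (by nlinarith) dist_nonneg |>.2

variable [MeasurableSpace X]

lemma Wdist_sq (μ ν : W2Space X) : Wdist μ ν ^ 2 = (W2cost μ.1 ν.1).toReal :=
  Real.sq_sqrt ENNReal.toReal_nonneg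

variable [BorelSpace X]

lemma W2Space.integrable_dist_sq (ν : W2Space X) (x : X) :
    Integrable (fun y => dist x y ^ 2) ν.1 := by
  obtain ⟨hν, x₀, hx₀⟩ := ν.2
  have h0 : Integrable (fun y => dist x₀ y ^ 2) ν.1 := by
    refine ⟨by fun_prop, ?_⟩
    rw [hasFiniteIntegral_iff_ofReal (Eventually.of_forall fun y => by positivity)]
    simpa only [ENNReal.ofReal_pow dist_nonneg] using hx₀
  refine ((h0.const_mul 2).add (integrable_const (2 * dist x x₀ ^ 2))).mono' (by fun_prop)
    (Eventually.of_forall fun y => ?_)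
  rw [Real.norm_of_nonneg (by positivity)]
  have h1 := dist_triangle x x₀ y
  have h2 : dist x y ^ 2 ≤ (dist x x₀ + dist x₀ y) ^ 2 := by gcongr
  simp only [Pi.add_apply]
  nlinarith [sq_nonneg (dist x x₀ - dist x₀ y)]

lemma IsCoupling.integrable_fst {π : Measure (X × X)} {μ ν : W2Space X}
    (h : IsCoupling π μ.1 ν.1) (x : X) : Integrable (fun p : X × X => dist x p.1 ^ 2) π := by
  have h1 := μ.integrable_dist_sq x
  rw [← h.1] at h1
  exact h1.comp_measurable measurable_fst

lemma IsCoupling.integrable_snd {π : Measure (X × X)} {μ ν : W2Space X}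
    (h : IsCoupling π μ.1 ν.1) (x : X) : Integrable (fun p : X × X => dist x p.2 ^ 2) π := by
  have h1 := ν.integrable_dist_sq x
  rw [← h.2] at h1
  exact h1.comp_measurable measurable_snd

lemma IsCoupling.integral_fst {π : Measure (X × X)} {μ ν : W2Space X}
    (h : IsCoupling π μ.1 ν.1) (x : X) :
    ∫ p, dist x p.1 ^ 2 ∂π = ∫ y, dist x y ^ 2 ∂μ.1 := by
  rw [← h.1, integral_map measurable_fst.aemeasurable (by fun_prop)]

lemma IsCoupling.integral_snd {π : Measure (X × X)} {μ ν : W2Space X}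
    (h : IsCoupling π μ.1 ν.1) (x : X) :
    ∫ p, dist x p.2 ^ 2 ∂π = ∫ y, dist x y ^ 2 ∂ν.1 := by
  rw [← h.2, integral_map measurable_snd.aemeasurable (by fun_prop)]

lemma integral_linear_combination {α : Type*} [MeasurableSpace α] {π : Measure α}
    {f g k : α → ℝ} (hf : Integrable f π) (hg : Integrable g π) (hk : Integrable k π)
    (a b c : ℝ) :
    ∫ p, (a * f p + b * g p + c * k p) ∂π =
      a * ∫ p, f p ∂π + b * ∫ p, g p ∂π + c * ∫ p, k p ∂π := by
  rw [integral_add ?_ (hk.const_mul c), integral_add (hf.const_mul a) (hg.const_mul b),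
    integral_const_mul, integral_const_mul, integral_const_mul]
  exact (hf.const_mul a).add (hg.const_mul b)

variable [SecondCountableTopology X]

lemma IsCoupling.integrable_dist_sq {π : Measure (X × X)} {μ ν : W2Space X}
    (h : IsCoupling π μ.1 ν.1) (x : X) : Integrable (fun p : X × X => dist p.1 p.2 ^ 2) π := by
  refine (((h.integrable_fst x).const_mul 2).add ((h.integrable_snd x).const_mul 2)).mono'
    (by fun_prop) (Eventually.of_forall fun p => ?_)
  rw [Real.norm_of_nonneg (by positivity)]
  have h1 := dist_triangle_left p.1 p.2 x
  have h2 : dist p.1 p.2 ^ 2 ≤ (dist x p.1 + dist x p.2) ^ 2 := by gcongr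
  simp only [Pi.add_apply]
  nlinarith [sq_nonneg (dist x p.1 - dist x p.2)]

lemma IsCoupling.lintegral_cost {π : Measure (X × X)} {μ ν : W2Space X}
    (h : IsCoupling π μ.1 ν.1) (x : X) :
    ∫⁻ p, ENNReal.ofReal (dist p.1 p.2) ^ 2 ∂π =
      ENNReal.ofReal (∫ p, dist p.1 p.2 ^ 2 ∂π) := by
  rw [ofReal_integral_eq_lintegral_ofReal (h.integrable_dist_sq x)
    (Eventually.of_forall fun p => by positivity)]
  simp only [ENNReal.ofReal_pow dist_nonneg]

lemma IsCoupling.Wdist_sq_le {π : Measure (X × X)} {μ ν : W2Space X}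
    (h : IsCoupling π μ.1 ν.1) (x : X) : Wdist μ ν ^ 2 ≤ ∫ p, dist p.1 p.2 ^ 2 ∂π := by
  rw [Wdist_sq]
  refine ENNReal.toReal_le_of_le_ofReal (integral_nonneg fun p => by positivity) ?_
  rw [← h.lintegral_cost x]
  exact iInf₂_le π h

lemma exists_coupling_lt (μ ν : W2Space X) (x : X) {ε : ℝ} (hε : 0 < ε) :
    ∃ π : Measure (X × X), IsCoupling π μ.1 ν.1 ∧
      ∫ p, dist p.1 p.2 ^ 2 ∂π < Wdist μ ν ^ 2 + ε := by
  have := μ.2.1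
  have := ν.2.1
  have hprod : IsCoupling (μ.1.prod ν.1) μ.1 ν.1 := by constructor <;> simp
  have hfin : W2cost μ.1 ν.1 ≠ ⊤ := by
    have hle : W2cost μ.1 ν.1 ≤ ∫⁻ p, ENNReal.ofReal (dist p.1 p.2) ^ 2 ∂(μ.1.prod ν.1) :=
      iInf₂_le (μ.1.prod ν.1) hprod
    rw [hprod.lintegral_cost x] at hle
    exact ne_top_of_le_ne_top ENNReal.ofReal_ne_top hle
  have hlt : W2cost μ.1 ν.1 < W2cost μ.1 ν.1 + ENNReal.ofReal ε :=
    ENNReal.lt_add_right hfin (by simpa using hε)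
  obtain ⟨π, hlt⟩ := iInf_lt_iff.1 hlt
  obtain ⟨hπ, h⟩ := iInf_lt_iff.1 hlt
  refine ⟨π, hπ, ?_⟩
  rw [hπ.lintegral_cost x, ← ENNReal.ofReal_toReal hfin, ← Wdist_sq,
    ← ENNReal.ofReal_add (sq_nonneg _) hε.le] at h
  exact (ENNReal.ofReal_lt_ofReal_iff_of_nonneg (integral_nonneg fun p => by positivity)).1 h

lemma Wdist_sq_of_eq_dirac {μ ν : W2Space X} {x : X} (hμ : μ.1 = Measure.dirac x) :
    Wdist μ ν ^ 2 = ∫ y, dist x y ^ 2 ∂ν.1 := by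
  have key : ∀ π, IsCoupling π μ.1 ν.1 →
      ∫ p, dist p.1 p.2 ^ 2 ∂π = ∫ y, dist x y ^ 2 ∂ν.1 := by
    intro π hπ
    rw [← hπ.integral_snd x]
    refine integral_congr_ae ?_
    have h1 : ∀ᵐ y ∂(π.map Prod.fst), y = x := by
      rw [hπ.1, hμ]
      exact (ae_dirac_iff (measurableSet_singleton x)).2 rfl
    filter_upwards [ae_of_ae_map measurable_fst.aemeasurable h1] with p hp
    rw [hp]
  refine le_antisymm ?_ (le_of_forall_pos_le_add fun ε hε => ?_)
  · obtain ⟨π, hπ, -⟩ := exists_coupling_lt μ ν x one_pos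
    exact (hπ.Wdist_sq_le x).trans_eq (key π hπ)
  · obtain ⟨π, hπ, h⟩ := exists_coupling_lt μ ν x hε
    rw [key π hπ] at h
    exact h.le

lemma measure_isClosed_le_of_forall_coupling {μ ν : Measure X} [IsFiniteMeasure ν]
    (h : ∀ ε : ℝ, 0 < ε → ∃ π : Measure (X × X), IsCoupling π μ ν ∧
      Integrable (fun p : X × X => dist p.1 p.2 ^ 2) π ∧ ∫ p, dist p.1 p.2 ^ 2 ∂π ≤ ε)
    {F : Set X} (hF : IsClosed F) : μ F ≤ ν F := by
  have hδ : ∀ δ : ℝ, 0 < δ → μ F ≤ ν (Metric.cthickening δ F) := by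
    intro δ hδ
    refine ENNReal.le_of_forall_pos_le_add fun ε hε _ => ?_
    obtain ⟨π, ⟨h1, h2⟩, hi, hle⟩ := h (δ ^ 2 * ε) (by positivity)
    have hm : π {p | δ ^ 2 ≤ dist p.1 p.2 ^ 2} ≤ ε := by
      have hmk := meas_ge_le_lintegral_div (μ := π)
        (f := fun p : X × X => ENNReal.ofReal (dist p.1 p.2 ^ 2))
        (by fun_prop) (ε := ENNReal.ofReal (δ ^ 2)) (by simp [hδ.ne']) ENNReal.ofReal_ne_top
      rw [← ofReal_integral_eq_lintegral_ofReal hi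
        (Eventually.of_forall fun p => by positivity),
        ← ENNReal.ofReal_div_of_pos (by positivity)] at hmk
      refine (measure_mono fun p hp => ENNReal.ofReal_le_ofReal hp).trans (hmk.trans ?_)
      rw [← ENNReal.ofReal_coe_nnreal]
      refine ENNReal.ofReal_le_ofReal ?_
      rw [div_le_iff₀ (by positivity)]
      linarith
    rw [← h1, Measure.map_apply measurable_fst hF.measurableSet, ← h2,
      Measure.map_apply measurable_snd Metric.isClosed_cthickening.measurableSet]
    refine le_trans ?_ ((measure_union_le _ _).trans (add_le_add le_rfl hm))
    refine measure_mono fun p hp => ?_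
    by_cases hd : dist p.1 p.2 ≤ δ
    · exact Or.inl (Metric.mem_cthickening_of_dist_le p.2 p.1 δ F hp (by rwa [dist_comm]))
    · right
      have := (not_le.1 hd).le
      simp only [Set.mem_ofPred_eq]
      gcongr
  refine ge_of_tendsto (x := 𝓝[>] (0:ℝ)) ((tendsto_measure_cthickening_of_isClosed
    ⟨1, one_pos, measure_ne_top _ _⟩ hF).mono_left nhdsWithin_le_nhds) ?_
  filter_upwards [self_mem_nhdsWithin] with δ hδ0 using hδ δ hδ0

lemma measure_eq_of_forall_coupling {μ ν : Measure X} [IsProbabilityMeasure μ]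
    [IsProbabilityMeasure ν]
    (h : ∀ ε : ℝ, 0 < ε → ∃ π : Measure (X × X), IsCoupling π μ ν ∧
      Integrable (fun p : X × X => dist p.1 p.2 ^ 2) π ∧ ∫ p, dist p.1 p.2 ^ 2 ∂π ≤ ε) :
    μ = ν := by
  refine ext_of_generate_finite {s | IsClosed s} ?_ isPiSystem_isClosed (fun F hF =>
    le_antisymm (measure_isClosed_le_of_forall_coupling h hF)
      (measure_isClosed_le_of_forall_coupling (fun ε hε => ?_) hF)) (by simp)
  · rw [BorelSpace.measurable_eq (α := X), borel_eq_generateFrom_isClosed]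
  · obtain ⟨π, ⟨h1, h2⟩, hi, hle⟩ := h ε hε
    refine ⟨π.map Prod.swap, ⟨?_, ?_⟩, ?_, ?_⟩
    · rw [Measure.map_map measurable_fst measurable_swap]
      exact h2
    · rw [Measure.map_map measurable_snd measurable_swap]
      exact h1
    · rw [integrable_map_measure (by fun_prop) measurable_swap.aemeasurable]
      simpa only [Function.comp_def, Prod.fst_swap, Prod.snd_swap, dist_comm] using hi
    · rw [integral_map measurable_swap.aemeasurable (by fun_prop)]
      simpa only [Prod.fst_swap, Prod.snd_swap, dist_comm] using hle

/-- Along a geodesic of `W₂(X)` issued from a Dirac mass, earlier measures are images of later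
ones under the homotheties centered at the base point. -/
lemma map_homothety_eq {x : X} {l r : ℝ} (hl : l ∈ Set.Icc (0:ℝ) 1) {h : X → X}
    (hh : ∀ y w, dist w (h y) ^ 2 ≤
      (1 - l) * dist w x ^ 2 + l * dist w y ^ 2 - l * (1 - l) * dist x y ^ 2)
    {μ ν : W2Space X} (hμ : ∫ y, dist x y ^ 2 ∂μ.1 = (l * r) ^ 2)
    (hν : ∫ y, dist x y ^ 2 ∂ν.1 = r ^ 2) (hW : Wdist μ ν ^ 2 = ((1 - l) * r) ^ 2) :
    ν.1.map h = μ.1 := by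
  have := μ.2.1
  have := ν.2.1
  have hm : Measurable h := (continuous_homothety hl hh).measurable
  have := Measure.isProbabilityMeasure_map (μ := ν.1) hm.aemeasurable
  refine (measure_eq_of_forall_coupling fun ε hε => ?_).symm
  obtain ⟨π, hπ, hc⟩ := exists_coupling_lt μ ν x hε
  have hf : Measurable fun p : X × X => (p.1, h p.2) := by fun_prop
  have i1 := hπ.integrable_fst x
  have i2 := hπ.integrable_snd x
  have i3 := hπ.integrable_dist_sq x
  have hb : ∀ p : X × X, dist p.1 (h p.2) ^ 2 ≤
      (1 - l) * dist x p.1 ^ 2 + l * dist p.1 p.2 ^ 2 + -(l * (1 - l)) * dist x p.2 ^ 2 := by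
    intro p
    simpa only [dist_comm x p.1, neg_mul, ← sub_eq_add_neg] using hh p.2 p.1
  have ib := ((i1.const_mul (1 - l)).add (i3.const_mul l)).add (i2.const_mul (-(l * (1 - l))))
  have ii : Integrable (fun p : X × X => dist p.1 (h p.2) ^ 2) π := by
    refine ib.mono' (by fun_prop) (Eventually.of_forall fun p => ?_)
    rw [Real.norm_of_nonneg (by positivity)]
    exact hb p
  refine ⟨π.map fun p => (p.1, h p.2), ⟨?_, ?_⟩, ?_, ?_⟩
  · rw [Measure.map_map measurable_fst hf]
    exact hπ.1
  · rw [Measure.map_map measurable_snd hf, ← hπ.2, Measure.map_map hm measurable_snd]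
    rfl
  · rw [integrable_map_measure (by fun_prop) hf.aemeasurable]
    exact ii
  · rw [integral_map hf.aemeasurable (by fun_prop)]
    refine (integral_mono ii ib hb).trans ?_
    simp only [Pi.add_apply]
    rw [integral_linear_combination i1 i3 i2, hπ.integral_fst, hπ.integral_snd, hμ, hν]
    rw [hW] at hc
    have h1 := mul_le_mul_of_nonneg_left hc.le hl.1
    have h2 := mul_le_mul_of_nonneg_right hl.2 hε.le
    linarith

lemma Wdist_sq_le_of_map_homothety {x : X} {l k : ℝ} (hl : l ∈ Set.Icc (0:ℝ) 1)
    (hk : k ∈ Set.Icc (0:ℝ) 1) {h g : X → X}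
    (hh : ∀ y w, dist w (h y) ^ 2 ≤
      (1 - l) * dist w x ^ 2 + l * dist w y ^ 2 - l * (1 - l) * dist x y ^ 2)
    (hg : ∀ y w, dist w (g y) ^ 2 ≤
      (1 - k) * dist w x ^ 2 + k * dist w y ^ 2 - k * (1 - k) * dist x y ^ 2)
    {μ μ' σ σ' : W2Space X} (hμ : μ'.1.map h = μ.1) (hσ : σ'.1.map g = σ.1) :
    Wdist μ σ ^ 2 ≤ (l ^ 2 - l * k) * ∫ y, dist x y ^ 2 ∂μ'.1
      + (k ^ 2 - l * k) * ∫ y, dist x y ^ 2 ∂σ'.1 + l * k * Wdist μ' σ' ^ 2 := by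
  have hhm : Measurable h := (continuous_homothety hl hh).measurable
  have hgm : Measurable g := (continuous_homothety hk hg).measurable
  refine le_of_forall_pos_le_add fun ε hε => ?_
  obtain ⟨π, hπ, hc⟩ := exists_coupling_lt μ' σ' x hε
  have hf : Measurable fun p : X × X => (h p.1, g p.2) := by fun_prop
  have hπf : IsCoupling (π.map fun p => (h p.1, g p.2)) μ.1 σ.1 := by
    constructor
    · rw [Measure.map_map measurable_fst hf, ← hμ, ← hπ.1, Measure.map_map hhm measurable_fst]
      rfl
    · rw [Measure.map_map measurable_snd hf, ← hσ, ← hπ.2, Measure.map_map hgm measurable_snd]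
      rfl
  have i1 := hπ.integrable_fst x
  have i2 := hπ.integrable_snd x
  have i3 := hπ.integrable_dist_sq x
  have ii : Integrable (fun p : X × X => dist (h p.1) (g p.2) ^ 2) π :=
    (hπf.integrable_dist_sq x).comp_measurable hf
  refine (hπf.Wdist_sq_le x).trans ?_
  rw [integral_map hf.aemeasurable (by fun_prop)]
  refine (integral_mono ii (((i1.const_mul (l ^ 2 - l * k)).add
    (i2.const_mul (k ^ 2 - l * k))).add (i3.const_mul (l * k)))
    fun p => dist_homothety_homothety_sq_le hk hh hg p.1 p.2).trans ?_
  simp only [Pi.add_apply]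
  rw [integral_linear_combination i1 i2 i3, hπ.integral_fst, hπ.integral_snd]
  have h0 : 0 ≤ l * k := mul_nonneg hl.1 hk.1
  have h1 := mul_le_mul_of_nonneg_left hc.le h0
  have h2 := mul_le_mul_of_nonneg_right (mul_le_one₀ hl.2 hk.1 hk.2) hε.le
  linarith

end WassersteinComparison

/-- Comparison of the distances between points of two geodesics of `W₂(X)` issued from the
same Dirac mass, in the form of the Euclidean law of cosines. -/
lemma IsHadamard.Wdist_sq_le {X : Type*} [MetricSpace X] [MeasurableSpace X] [BorelSpace X]
    (hX : IsHadamard X) {x : X} {Lm Ls : ℝ≥0∞} {μ σ : ℝ≥0 → W2Space X}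
    (hμ0 : (μ 0).1 = Measure.dirac x) (hσ0 : (σ 0).1 = Measure.dirac x)
    (hμ : ∀ s t : ℝ≥0, (s : ℝ≥0∞) ≤ Lm → (t : ℝ≥0∞) ≤ Lm → Wdist (μ s) (μ t) = dist s t)
    (hσ : ∀ s t : ℝ≥0, (s : ℝ≥0∞) ≤ Ls → (t : ℝ≥0∞) ≤ Ls → Wdist (σ s) (σ t) = dist s t)
    {s s' t t' : ℝ≥0} (hs : 0 < s) (ht : 0 < t) (hss : s ≤ s') (htt : t ≤ t')
    (hsL : (s' : ℝ≥0∞) ≤ Lm) (htL : (t' : ℝ≥0∞) ≤ Ls) :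
    Wdist (μ s) (σ t) ^ 2 ≤ (s : ℝ) ^ 2 + (t : ℝ) ^ 2 - (s / s' : ℝ) * (t / t' : ℝ) *
      ((s' : ℝ) ^ 2 + (t' : ℝ) ^ 2 - Wdist (μ s') (σ t') ^ 2) := by
  have := hX.separable
  have : SecondCountableTopology X := UniformSpace.secondCountable_of_separable X
  have geod : ∀ (L : ℝ≥0∞) (ρ : ℝ≥0 → W2Space X), (ρ 0).1 = Measure.dirac x →
      (∀ s t : ℝ≥0, (s : ℝ≥0∞) ≤ L → (t : ℝ≥0∞) ≤ L → Wdist (ρ s) (ρ t) = dist s t) →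
      ∀ r r' : ℝ≥0, 0 < r → r ≤ r' → (r' : ℝ≥0∞) ≤ L →
      (r / r' : ℝ) ∈ Set.Icc (0:ℝ) 1 ∧ ∫ y, dist x y ^ 2 ∂(ρ r').1 = (r' : ℝ) ^ 2 ∧
      ∃ h : X → X, (∀ y w, dist w (h y) ^ 2 ≤ (1 - (r / r' : ℝ)) * dist w x ^ 2
        + (r / r' : ℝ) * dist w y ^ 2 - (r / r' : ℝ) * (1 - (r / r' : ℝ)) * dist x y ^ 2) ∧
        (ρ r').1.map h = (ρ r).1 := by
    intro L ρ h0 hρ r r' hr hrr hrL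
    have hr' : (0:ℝ) < r' := by exact_mod_cast hr.trans_le hrr
    have hrr' : (r:ℝ) ≤ r' := by exact_mod_cast hrr
    have hl : (r / r' : ℝ) ∈ Set.Icc (0:ℝ) 1 := ⟨by positivity, (div_le_one hr').2 hrr'⟩
    have hm : ∀ q : ℝ≥0, (q : ℝ≥0∞) ≤ L → ∫ y, dist x y ^ 2 ∂(ρ q).1 = (q : ℝ) ^ 2 := by
      intro q hq
      rw [← Wdist_sq_of_eq_dirac h0, hρ 0 q (by simp) hq, NNReal.dist_eq]
      simp
    have hrL' : (r : ℝ≥0∞) ≤ L := (ENNReal.coe_le_coe.2 hrr).trans hrL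
    obtain ⟨h, hh⟩ := hX.exists_homothety x hl
    refine ⟨hl, hm r' hrL, h, hh, map_homothety_eq (r := r') hl hh ?_ (hm r' hrL) ?_⟩
    · rw [hm r hrL', div_mul_cancel₀ _ hr'.ne']
    · rw [hρ r r' hrL' hrL, NNReal.dist_eq, sq_abs, sub_mul, div_mul_cancel₀ _ hr'.ne']
      ring
  obtain ⟨hl, hms, h, hh, hhμ⟩ := geod Lm μ hμ0 hμ s s' hs hss hsL
  obtain ⟨hk, hmt, g, hg, hgσ⟩ := geod Ls σ hσ0 hσ t t' ht htt htL
  have key := Wdist_sq_le_of_map_homothety hl hk hh hg hhμ hgσ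
  have hs' : (s' : ℝ) ≠ 0 := by exact_mod_cast (hs.trans_le hss).ne'
  have ht' : (t' : ℝ) ≠ 0 := by exact_mod_cast (ht.trans_le htt).ne'
  have e1 : (s / s' : ℝ) ^ 2 * (s' : ℝ) ^ 2 = (s : ℝ) ^ 2 := by field_simp
  have e2 : (t / t' : ℝ) ^ 2 * (t' : ℝ) ^ 2 = (t : ℝ) ^ 2 := by field_simp
  rw [hms, hmt] at key
  linarith

/-- **Statement 14.** For two unit-speed geodesics of `W₂(X)` starting at a Dirac mass, the
Euclidean comparison angle at the Dirac mass is a nondecreasing function of the two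
parameters; consequently `t ↦ W(μ_t, σ_t)/t` is nondecreasing. -/
theorem comparison_angle_monotone
    (X : Type*) [MetricSpace X] [MeasurableSpace X] [BorelSpace X]
    (hX : IsHadamard X) (x : X) (Lm Ls : ℝ≥0∞) (μ σ : ℝ≥0 → W2Space X)
    (hμ0 : (μ 0).1 = Measure.dirac x) (hσ0 : (σ 0).1 = Measure.dirac x)
    (hμ : ∀ s t : ℝ≥0, (s : ℝ≥0∞) ≤ Lm → (t : ℝ≥0∞) ≤ Lm → Wdist (μ s) (μ t) = dist s t)
    (hσ : ∀ s t : ℝ≥0, (s : ℝ≥0∞) ≤ Ls → (t : ℝ≥0∞) ≤ Ls → Wdist (σ s) (σ t) = dist s t) :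
    (∀ s s' t t' : ℝ≥0, 0 < s → 0 < t → s ≤ s' → t ≤ t' →
      (s' : ℝ≥0∞) ≤ Lm → (t' : ℝ≥0∞) ≤ Ls →
      Real.arccos (((s : ℝ) ^ 2 + (t : ℝ) ^ 2 - Wdist (μ s) (σ t) ^ 2) /
          (2 * (s : ℝ) * (t : ℝ))) ≤
        Real.arccos (((s' : ℝ) ^ 2 + (t' : ℝ) ^ 2 - Wdist (μ s') (σ t') ^ 2) /
          (2 * (s' : ℝ) * (t' : ℝ)))) ∧
    (∀ t t' : ℝ≥0, 0 < t → t ≤ t' → (t' : ℝ≥0∞) ≤ Lm → (t' : ℝ≥0∞) ≤ Ls →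
      Wdist (μ t) (σ t) / (t : ℝ) ≤ Wdist (μ t') (σ t') / (t' : ℝ)) := by
  refine ⟨fun s s' t t' hs ht hss htt hsL htL => Real.antitone_arccos ?_,
    fun t t' ht htt htm hts => ?_⟩
  · have key := hX.Wdist_sq_le hμ0 hσ0 hμ hσ hs ht hss htt hsL htL
    have hs0 : (0:ℝ) < s := by exact_mod_cast hs
    have ht0 : (0:ℝ) < t := by exact_mod_cast ht
    have hs' : (0:ℝ) < s' := by exact_mod_cast hs.trans_le hss
    have ht' : (0:ℝ) < t' := by exact_mod_cast ht.trans_le htt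
    rw [le_div_iff₀ (by positivity)]
    refine le_trans (le_of_eq ?_) (le_sub_comm.1 key)
    field_simp
  · have key := hX.Wdist_sq_le hμ0 hσ0 hμ hσ ht ht htt htt htm hts
    have ht' : (0:ℝ) < t' := by exact_mod_cast ht.trans_le htt
    have ht0 : (0:ℝ) < t := by exact_mod_cast ht
    have hsq : Wdist (μ t) (σ t) ^ 2 ≤ (Wdist (μ t') (σ t') / t' * t) ^ 2 := by
      refine key.trans (le_of_eq ?_)
      field_simp
      ring
    rw [div_le_iff₀ ht0]
    have h0 : 0 ≤ Wdist (μ t') (σ t') := Real.sqrt_nonneg _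
    exact abs_le_of_sq_le_sq' hsq (by positivity) |>.2

end
end

section
/- Let Y be a locally compact, geodesically complete, geodesic Polish metric space. Then any geodesic segment in W₂(Y) issued from a Dirac mass δ_x can be extended to a geodesic ray defined on [0,∞) with the same speed. -/
open MeasureTheory Filter Set Topology
open scoped NNReal ENNReal

noncomputable section


/-! ## Hopf–Rinow: complete locally compact geodesic spaces are proper -/

/-- In a geodesic space, a point within `R` of `x` is within `R - r` of a point of the closed
ball of radius `r` around `x`. -/
lemma IsGeodesicSpace.exists_mem_closedBall {Y : Type*} [MetricSpace Y] (hgeo : IsGeodesicSpace Y)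
    {x y : Y} {r R : ℝ} (hr : 0 ≤ r) (hrR : r ≤ R) (hy : dist x y ≤ R) :
    ∃ z ∈ Metric.closedBall x r, dist y z ≤ R - r := by
  rcases le_or_gt (dist x y) r with h | h
  · exact ⟨y, by simpa [dist_comm] using h, by simpa using hrR⟩
  · obtain ⟨γ, h0, h1, hγ⟩ := hgeo x y
    have hd : 0 < dist x y := hr.trans_lt h
    have hmem : r / dist x y ∈ Icc (0 : ℝ) 1 := ⟨by positivity, (div_le_one hd).2 h.le⟩
    refine ⟨γ (r / dist x y), ?_, ?_⟩
    · have := hγ _ hmem 0 (by simp)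
      rw [h0, sub_zero, abs_of_nonneg hmem.1, mul_div_cancel₀ _ hd.ne'] at this
      exact this.le
    · have := hγ 1 (by simp) _ hmem
      rw [h1, abs_of_nonneg (by linarith [hmem.2]), mul_sub, mul_div_cancel₀ _ hd.ne'] at this
      linarith

/-- **Hopf–Rinow**: a complete, locally compact, geodesic space is proper. -/
lemma IsGeodesicSpace.properSpace {Y : Type*} [MetricSpace Y] [CompleteSpace Y]
    [LocallyCompactSpace Y] (hgeo : IsGeodesicSpace Y) : ProperSpace Y := by
  refine .of_isCompact_closedBall_of_le 0 fun x r _ => ?_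
  by_contra hr
  set S : Set ℝ := {r | IsCompact (Metric.closedBall x r)} with hS
  have hdown : ∀ a ∈ S, ∀ b ≤ a, b ∈ S := fun a ha b hb =>
    IsCompact.of_isClosed_subset ha Metric.isClosed_closedBall
      (Metric.closedBall_subset_closedBall hb)
  have hbdd : BddAbove S := ⟨r, fun a ha => le_of_not_gt fun h => hr (hdown a ha r h.le)⟩
  have h0 : (0 : ℝ) ∈ S := by simp [hS]
  have hρ0 : 0 ≤ sSup S := le_csSup hbdd h0
  have hlt : ∀ a < sSup S, a ∈ S := fun a ha => by
    obtain ⟨b, hb, hab⟩ := exists_lt_of_lt_csSup ⟨0, h0⟩ ha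
    exact hdown b hb a hab.le
  have hρ : IsCompact (Metric.closedBall x (sSup S)) := by
    refine isCompact_iff_totallyBounded_isComplete.2
      ⟨Metric.totallyBounded_iff.2 fun ε hε => ?_, Metric.isClosed_closedBall.isComplete⟩
    have hs : max 0 (sSup S - ε / 2) ∈ S := by
      rcases max_choice 0 (sSup S - ε / 2) with h | h <;> rw [h]
      · exact h0
      · exact hlt _ (by linarith)
    obtain ⟨t, ht, htc⟩ := Metric.totallyBounded_iff.1
      (IsCompact.totallyBounded (show IsCompact _ from hs)) (ε / 2) (by positivity)
    refine ⟨t, ht, fun y hy => ?_⟩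
    obtain ⟨z, hz, hyz⟩ := hgeo.exists_mem_closedBall (le_max_left 0 (sSup S - ε / 2))
      (max_le hρ0 (by linarith)) (by simpa [dist_comm] using hy)
    obtain ⟨w, hw, hzw⟩ := mem_iUnion₂.1 (htc hz)
    refine mem_iUnion₂.2 ⟨w, hw, ?_⟩
    have := dist_triangle y z w
    have := le_max_right 0 (sSup S - ε / 2)
    rw [Metric.mem_ball] at hzw ⊢
    linarith
  obtain ⟨δ, hδ, hc⟩ := hρ.exists_isCompact_cthickening
  have : sSup S + δ ∈ S := by
    refine IsCompact.of_isClosed_subset hc Metric.isClosed_closedBall fun y hy => ?_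
    obtain ⟨z, hz, hyz⟩ := hgeo.exists_mem_closedBall hρ0 (R := sSup S + δ) (by linarith)
      (by simpa [dist_comm] using hy)
    exact Metric.mem_cthickening_of_dist_le y z δ _ hz (by linarith)
  linarith [le_csSup hbdd this]

/-! ## Measurable sections -/

/-- Given countably many measurable sets covering the space, there is a measurable way of
choosing one that contains a given point. -/
lemma exists_measurable_nat_mem {α : Type*} [MeasurableSpace α] {S : ℕ → Set α}
    (hS : ∀ k, MeasurableSet (S k)) (hcov : ∀ a, ∃ k, a ∈ S k) :
    ∃ n : α → ℕ, Measurable n ∧ ∀ a, a ∈ S (n a) := by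
  classical
  exact ⟨fun a => Nat.find (hcov a), measurable_find hcov hS, fun a => Nat.find_spec (hcov a)⟩

/-- A continuous surjection from a σ-compact Polish space has a measurable section. -/
lemma exists_measurable_section {Z Y : Type*} [TopologicalSpace Z] [PolishSpace Z]
    [SigmaCompactSpace Z] [MeasurableSpace Z] [BorelSpace Z] [TopologicalSpace Y] [T2Space Y]
    [MeasurableSpace Y] [BorelSpace Y] {e : Z → Y} (he : Continuous e)
    (hsurj : Function.Surjective e) :
    ∃ s : Y → Z, Measurable s ∧ ∀ y, e (s y) = y := by
  let := TopologicalSpace.upgradeIsCompletelyMetrizable Z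
  rcases isEmpty_or_nonempty Z with hZ | hZ
  · have : IsEmpty Y := ⟨fun y => hZ.elim (hsurj y).choose⟩
    exact ⟨isEmptyElim, measurable_of_empty _, isEmptyElim⟩
  have himage : ∀ C : Set Z, IsClosed C → MeasurableSet (e '' C) := fun C hC => by
    obtain ⟨K, hK, hKC⟩ := (isSigmaCompact_univ.of_isClosed_subset hC (subset_univ C)).image he
    rw [← hKC]
    exact .iUnion fun n => (hK n).measurableSet
  set z := TopologicalSpace.denseSeq Z
  have hz : ∀ (p : Z) {r : ℝ}, 0 < r → ∃ k, dist p (z k) < r := fun p r hr =>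
    (TopologicalSpace.denseRange_denseSeq Z).exists_dist_lt p hr
  set good : ℕ → Set (Y → Z) := fun n =>
    {g | Measurable g ∧ ∀ y, y ∈ e '' Metric.closedBall (g y) ((1 / 2) ^ n)}
  have hinit : ∃ g, g ∈ good 0 := by
    obtain ⟨n, hn, hmem⟩ := exists_measurable_nat_mem
      (S := fun k => e '' Metric.closedBall (z k) ((1 / 2) ^ 0))
      (fun k => himage _ Metric.isClosed_closedBall) fun y => by
        obtain ⟨p, rfl⟩ := hsurj y
        obtain ⟨k, hk⟩ := hz p (r := (1 / 2) ^ 0) (by positivity)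
        exact ⟨k, p, hk.le, rfl⟩
    exact ⟨fun y => z (n y), (measurable_from_nat (f := z)).comp hn, hmem⟩
  have hstep : ∀ n, ∀ g ∈ good n,
      ∃ g' ∈ good (n + 1), ∀ y, dist (g y) (g' y) ≤ 2 * (1 / 2) ^ n := by
    rintro n g ⟨hgm, hg⟩
    obtain ⟨m, hm, hmem⟩ := exists_measurable_nat_mem
      (S := fun k => e '' Metric.closedBall (z k) ((1 / 2) ^ (n + 1)) ∩
        {y | dist (g y) (z k) ≤ 2 * (1 / 2) ^ n})
      (fun k => (himage _ Metric.isClosed_closedBall).inter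
        (measurableSet_le (hgm.dist measurable_const) measurable_const)) fun y => by
        obtain ⟨p, hp, hpy⟩ := hg y
        obtain ⟨k, hk⟩ := hz p (r := (1 / 2) ^ (n + 1)) (by positivity)
        refine ⟨k, ⟨p, hk.le, hpy⟩, ?_⟩
        have := dist_triangle_left (g y) (z k) p
        rw [Metric.mem_closedBall] at hp
        rw [pow_succ] at hk
        have : (0 : ℝ) < (1 / 2) ^ n := by positivity
        simp only [mem_ofPred_eq]
        linarith
    exact ⟨fun y => z (m y), ⟨(measurable_from_nat (f := z)).comp hm, fun y => (hmem y).1⟩,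
      fun y => (hmem y).2⟩
  choose g₀ hg₀ using hinit
  choose! next hnext hdist using hstep
  set g : ℕ → Y → Z := fun n => Nat.rec g₀ next n
  have hgood : ∀ n, g n ∈ good n := fun n => by
    induction n with
    | zero => exact hg₀
    | succ n ih => exact hnext n _ ih
  have hlim : ∀ y, ∃ p, Tendsto (fun n => g n y) atTop (𝓝 p) := fun y =>
    cauchySeq_tendsto_of_complete <| cauchySeq_of_le_geometric (1 / 2) 2 (by norm_num)
      fun n => hdist n (g n) (hgood n) y
  choose s hs using hlim
  refine ⟨s, measurable_of_tendsto_metrizable (fun n => (hgood n).1) (tendsto_pi_nhds.2 hs),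
    fun y => ?_⟩
  have hp : ∀ n, ∃ p, dist p (g n y) ≤ (1 / 2) ^ n ∧ e p = y := fun n => (hgood n).2 y
  choose p hp hpy using hp
  have hps : Tendsto p atTop (𝓝 (s y)) := by
    refine (tendsto_iff_of_dist ?_).2 (hs y)
    exact squeeze_zero (fun _ => dist_nonneg) hp
      (tendsto_pow_atTop_nhds_zero_of_lt_one (by norm_num) (by norm_num))
  refine tendsto_nhds_unique ((he.tendsto _).comp hps) ?_
  simp [Function.comp_def, hpy]

/-! ## Measurable choice of geodesic rays -/

/-- Restrictions to rational times of the geodesic rays issued from `x`. -/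
def rationalRays {Y : Type*} [MetricSpace Y] (x : Y) : Set (ℚ≥0 → Y) :=
  {c | c 0 = x ∧ ∀ s t : ℚ≥0, dist (c s) (c t) = dist x (c 1) * |(s : ℝ) - t|}

lemma isClosed_rationalRays {Y : Type*} [MetricSpace Y] (x : Y) : IsClosed (rationalRays x) := by
  simp only [rationalRays, ofPred_and, ofPred_forall]
  refine (isClosed_eq (by fun_prop) (by fun_prop)).inter ?_
  exact isClosed_iInter fun s => isClosed_iInter fun t => isClosed_eq (by fun_prop) (by fun_prop)

lemma isSigmaCompact_rationalRays {Y : Type*} [MetricSpace Y] [ProperSpace Y] (x : Y) :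
    IsSigmaCompact (rationalRays x) := by
  refine .of_isClosed_subset (t := ⋃ n : ℕ, univ.pi fun q : ℚ≥0 => Metric.closedBall x (n * q))
    (isSigmaCompact_iUnion_of_isCompact _ fun n =>
      isCompact_univ_pi fun q => isCompact_closedBall _ _) (isClosed_rationalRays x) ?_
  rintro c ⟨h0, hc⟩
  obtain ⟨n, hn⟩ := exists_nat_ge (dist x (c 1))
  refine mem_iUnion.2 ⟨n, fun q _ => ?_⟩
  have := hc q 0
  rw [h0] at this
  rw [Metric.mem_closedBall, this]
  simp only [NNRat.cast_zero, sub_zero]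
  rw [abs_of_nonneg (by positivity)]
  gcongr

lemma exists_mem_rationalRays {Y : Type*} [MetricSpace Y] (hgeo : IsGeodesicSpace Y)
    (hgc : GeodesicallyComplete Y) (x y : Y) : ∃ c ∈ rationalRays x, c 1 = y := by
  obtain ⟨γ, h0, h1, hγ⟩ := hgeo x y
  obtain ⟨g, hg, hgγ⟩ := hgc γ 0 1 _ one_pos hγ
  have hg1 : g 1 = y := by rw [hgγ 1 (by simp), h1]
  refine ⟨fun q => g q, ⟨?_, fun s t => ?_⟩, by simpa using hg1⟩
  · simpa [h0] using hgγ 0 (by simp)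
  · simpa [hg1] using hg s (mem_univ _) t (mem_univ _)

/-- In a proper, geodesically complete geodesic space, one can choose measurably, for each `y`,
a geodesic ray issued from `x` and passing through `y` at time `1`. -/
lemma exists_measurable_rays {Y : Type*} [MetricSpace Y] [MeasurableSpace Y] [BorelSpace Y]
    [ProperSpace Y] (hgeo : IsGeodesicSpace Y) (hgc : GeodesicallyComplete Y) (x : Y) :
    ∃ φ : ℝ → Y → Y, (∀ t, 0 ≤ t → Measurable (φ t)) ∧ (∀ y, φ 0 y = x) ∧ (∀ y, φ 1 y = y) ∧
      ∀ s t, 0 ≤ s → 0 ≤ t → ∀ y, dist (φ s y) (φ t y) = dist x y * |s - t| := by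
  have : PolishSpace (rationalRays x) := (isClosed_rationalRays x).polishSpace
  have : SigmaCompactSpace (rationalRays x) :=
    isSigmaCompact_iff_sigmaCompactSpace.1 (isSigmaCompact_rationalRays x)
  obtain ⟨c, hcm, hc1⟩ := exists_measurable_section (Z := rationalRays x)
    (e := fun c => c.1 1) ((continuous_apply 1).comp continuous_subtype_val) fun y => by
      obtain ⟨c, hc, rfl⟩ := exists_mem_rationalRays hgeo hgc x y
      exact ⟨⟨c, hc⟩, rfl⟩
  have hc0 : ∀ y, (c y).1 0 = x := fun y => (c y).2.1
  have hc : ∀ y s t, dist ((c y).1 s) ((c y).1 t) = dist x y * |(s : ℝ) - t| := fun y s t => by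
    rw [(c y).2.2 s t, hc1]
  have happrox : ∀ t : ℝ, ∃ q : ℕ → ℚ≥0, 0 ≤ t → Tendsto (fun n => (q n : ℝ)) atTop (𝓝 t) := by
    intro t
    refine ⟨fun n => (⌊t * n⌋₊ : ℚ≥0) / n, fun ht => ?_⟩
    simpa [Function.comp_def] using
      (tendsto_nat_floor_mul_div_atTop ht).comp tendsto_natCast_atTop_atTop
  choose q hq using happrox
  have hlim : ∀ t y, ∃ p, 0 ≤ t → Tendsto (fun n => (c y).1 (q t n)) atTop (𝓝 p) := by
    intro t y
    by_cases ht : 0 ≤ t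
    swap; · exact ⟨x, fun h => absurd h ht⟩
    have hcau : CauchySeq fun n => (c y).1 (q t n) := by
      rw [cauchySeq_iff_tendsto_dist_atTop_0]
      have := (cauchySeq_iff_tendsto_dist_atTop_0.1 (hq t ht).cauchySeq).const_mul (dist x y)
      simpa [hc, Real.dist_eq] using this
    exact (cauchySeq_tendsto_of_complete hcau).imp fun p hp _ => hp
  choose φ hφ using hlim
  have hdist : ∀ s t, 0 ≤ s → 0 ≤ t → ∀ y, dist (φ s y) (φ t y) = dist x y * |s - t| := by
    intro s t hs ht y
    refine tendsto_nhds_unique ((hφ s y hs).dist (hφ t y ht)) ?_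
    simp only [hc]
    exact (((hq s hs).sub (hq t ht)).abs).const_mul _
  have hrat : ∀ (r : ℚ≥0) y, φ r y = (c y).1 r := by
    intro r y
    have hr : (0 : ℝ) ≤ r := by positivity
    rw [← dist_eq_zero]
    refine tendsto_nhds_unique ((hφ r y hr).dist tendsto_const_nhds) ?_
    simp only [hc]
    simpa using (((hq r hr).sub_const (r : ℝ)).abs).const_mul (dist x y)
  refine ⟨φ, fun t ht => ?_, fun y => ?_, fun y => ?_, hdist⟩
  · exact measurable_of_tendsto_metrizable
      (fun n => (measurable_pi_apply (q t n)).comp (measurable_subtype_coe.comp hcm))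
      (tendsto_pi_nhds.2 fun y => hφ t y ht)
  · simpa [hc0] using hrat 0 y
  · simpa [hc1] using hrat 1 y

/-! ## The Wasserstein distance through random variables -/

/-- The `L²` distance between two maps into a metric space. -/
def l2dist {α Y : Type*} [MetricSpace Y] [MeasurableSpace α] (ρ : Measure α) (u v : α → Y) :
    ℝ≥0∞ :=
  (∫⁻ a, ENNReal.ofReal (dist (u a) (v a)) ^ 2 ∂ρ) ^ (1 / 2 : ℝ)

/-- The Wasserstein distance between arbitrary measures, with values in `[0,∞]`. -/
def ewdist {Y : Type*} [MetricSpace Y] [MeasurableSpace Y] (μ ν : Measure Y) : ℝ≥0∞ :=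
  W2cost μ ν ^ (1 / 2 : ℝ)

section l2dist

variable {α β Y : Type*} [MetricSpace Y] [MeasurableSpace α] [MeasurableSpace β]

lemma l2dist_comm (ρ : Measure α) (u v : α → Y) : l2dist ρ u v = l2dist ρ v u := by
  simp [l2dist, dist_comm]

lemma l2dist_congr_left {ρ : Measure α} {u u' : α → Y} (h : u =ᵐ[ρ] u') (v : α → Y) :
    l2dist ρ u v = l2dist ρ u' v := by
  unfold l2dist
  congr 1
  refine lintegral_congr_ae ?_
  filter_upwards [h] with a ha
  rw [ha]

lemma l2dist_const_ne_top (ρ : Measure α) [IsFiniteMeasure ρ] (x y : Y) :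
    l2dist ρ (fun _ => x) (fun _ => y) ≠ ⊤ := by
  simp only [l2dist, lintegral_const]
  exact ENNReal.rpow_ne_top_of_nonneg (by norm_num) (by finiteness)

/-- `L²` distance along maps whose pointwise distances are proportional. -/
lemma l2dist_eq_mul (ρ : Measure α) {u v u' v' : α → Y} {k : ℝ}
    (h : ∀ a, dist (u a) (v a) = dist (u' a) (v' a) * k) :
    l2dist ρ u v = l2dist ρ u' v' * ENNReal.ofReal k := by
  unfold l2dist
  have : ∀ a, ENNReal.ofReal (dist (u a) (v a)) ^ 2
      = ENNReal.ofReal (dist (u' a) (v' a)) ^ 2 * ENNReal.ofReal k ^ 2 := fun a => by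
    rw [h, ENNReal.ofReal_mul dist_nonneg, mul_pow]
  simp_rw [this]
  rw [lintegral_mul_const' _ _ (by finiteness), ENNReal.mul_rpow_of_nonneg _ _ (by norm_num)]
  congr 1
  rw [← ENNReal.rpow_two, ← ENNReal.rpow_mul]
  norm_num

variable [MeasurableSpace Y] [BorelSpace Y] [SecondCountableTopology Y]

lemma l2dist_map {ρ : Measure α} {h : α → β} (hh : Measurable h) {u v : β → Y}
    (hu : Measurable u) (hv : Measurable v) :
    l2dist (ρ.map h) u v = l2dist ρ (fun a => u (h a)) (fun a => v (h a)) := by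
  unfold l2dist
  rw [lintegral_map ((hu.dist hv).ennreal_ofReal.pow_const 2) hh]

lemma l2dist_triangle (ρ : Measure α) {u v w : α → Y} (hu : Measurable u) (hv : Measurable v)
    (hw : Measurable w) : l2dist ρ u w ≤ l2dist ρ u v + l2dist ρ v w := by
  unfold l2dist
  simp_rw [← ENNReal.rpow_two]
  refine le_trans ?_ (ENNReal.lintegral_Lp_add_le (p := 2) (hu.dist hv).ennreal_ofReal.aemeasurable
    (hv.dist hw).ennreal_ofReal.aemeasurable (by norm_num))
  gcongr with a
  rw [Pi.add_apply, ← ENNReal.ofReal_add dist_nonneg dist_nonneg]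
  exact ENNReal.ofReal_le_ofReal (dist_triangle _ _ _)

end l2dist

section ewdist

variable {α Y : Type*} [MetricSpace Y] [MeasurableSpace α] [MeasurableSpace Y]

lemma ewdist_eq_iInf (μ ν : Measure Y) :
    ewdist μ ν = ⨅ π : {π : Measure (Y × Y) // IsCoupling π μ ν}, l2dist π.1 Prod.fst Prod.snd := by
  unfold ewdist W2cost l2dist
  rw [iInf_subtype']
  exact (ENNReal.orderIsoRpow (1 / 2) (by norm_num)).map_iInf _

lemma Wdist_eq_toReal (μ ν : W2Space Y) : Wdist μ ν = (ewdist μ.1 ν.1).toReal := by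
  rw [Wdist, ewdist, Real.sqrt_eq_rpow, ENNReal.toReal_rpow]

lemma W2Space.exists_l2dist_ne_top (μ : W2Space Y) : ∃ x, l2dist μ.1 (fun _ => x) id ≠ ⊤ :=
  μ.2.2.imp fun _ hx => ENNReal.rpow_ne_top_of_nonneg (by norm_num) hx.ne

variable [BorelSpace Y] [SecondCountableTopology Y]

lemma ewdist_map_le (ρ : Measure α) {u v : α → Y} (hu : Measurable u) (hv : Measurable v) :
    ewdist (ρ.map u) (ρ.map v) ≤ l2dist ρ u v := by
  have hc : IsCoupling (ρ.map fun a => (u a, v a)) (ρ.map u) (ρ.map v) :=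
    ⟨Measure.map_map measurable_fst (hu.prodMk hv), Measure.map_map measurable_snd (hu.prodMk hv)⟩
  rw [ewdist_eq_iInf, ← l2dist_map (hu.prodMk hv) measurable_fst measurable_snd]
  exact iInf_le_of_le ⟨_, hc⟩ le_rfl

lemma ewdist_comm (μ ν : Measure Y) : ewdist μ ν = ewdist ν μ := by
  have key : ∀ μ ν : Measure Y, ewdist μ ν ≤ ewdist ν μ := fun μ ν => by
    rw [ewdist_eq_iInf ν μ]
    refine le_iInf ?_
    rintro ⟨π, rfl, rfl⟩
    rw [l2dist_comm]
    exact ewdist_map_le π measurable_snd measurable_fst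
  exact le_antisymm (key μ ν) (key ν μ)

lemma ewdist_dirac (x : Y) (μ : Measure Y) [IsProbabilityMeasure μ] :
    ewdist (Measure.dirac x) μ = l2dist μ (fun _ => x) id := by
  refine le_antisymm ?_ ?_
  · simpa using ewdist_map_le μ (u := fun _ => x) (v := id) measurable_const measurable_id
  · rw [ewdist_eq_iInf]
    refine le_iInf ?_
    rintro ⟨π, hπ, rfl⟩
    have : (Prod.fst : Y × Y → Y) =ᵐ[π] fun _ => x := by
      have h : ∀ᵐ y ∂(π.map Prod.fst), y = x := by
        rw [hπ]
        exact (ae_dirac_iff (measurableSet_singleton x)).2 rfl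
      exact ae_of_ae_map measurable_fst.aemeasurable h
    rw [l2dist_congr_left this, l2dist_map measurable_snd measurable_const measurable_id]
    rfl

/-- Triangle inequality, when the first measure is a Dirac mass. -/
lemma ewdist_dirac_triangle (x : Y) (μ ν : Measure Y) [IsProbabilityMeasure μ]
    [IsProbabilityMeasure ν] :
    ewdist (Measure.dirac x) ν ≤ ewdist (Measure.dirac x) μ + ewdist μ ν := by
  rw [ewdist_dirac, ewdist_dirac, ewdist_eq_iInf μ ν, ENNReal.add_iInf]
  refine le_iInf ?_
  rintro ⟨π, rfl, rfl⟩
  rw [l2dist_map measurable_fst measurable_const measurable_id,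
    l2dist_map measurable_snd measurable_const measurable_id]
  exact l2dist_triangle π measurable_const measurable_fst measurable_snd

/-- Triangle inequality, when the last measure is the image by a map of the second one. -/
lemma ewdist_map_triangle (μ ν : Measure Y) {h : Y → Y} (hh : Measurable h) :
    ewdist μ (ν.map h) ≤ ewdist μ ν + l2dist ν id h := by
  rw [ewdist_eq_iInf μ ν, ENNReal.iInf_add]
  refine le_iInf ?_
  rintro ⟨π, rfl, rfl⟩
  rw [l2dist_map measurable_snd measurable_id hh, Measure.map_map hh measurable_snd]
  exact (ewdist_map_le π measurable_fst (hh.comp measurable_snd)).trans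
    (l2dist_triangle π measurable_fst measurable_snd (hh.comp measurable_snd))

lemma ewdist_ne_top (μ ν : W2Space Y) : ewdist μ.1 ν.1 ≠ ⊤ := by
  obtain ⟨x, hx⟩ := μ.exists_l2dist_ne_top
  obtain ⟨y, hy⟩ := ν.exists_l2dist_ne_top
  have := μ.2.1
  have := ν.2.1
  set ρ := μ.1.prod ν.1
  have h1 : ρ.map Prod.fst = μ.1 := by simp [ρ]
  have h2 : ρ.map Prod.snd = ν.1 := by simp [ρ]
  rw [← h1, l2dist_map measurable_fst measurable_const measurable_id] at hx
  rw [← h2, l2dist_map measurable_snd measurable_const measurable_id] at hy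
  have hle := ewdist_map_le ρ measurable_fst measurable_snd
  rw [h1, h2] at hle
  refine ne_top_of_le_ne_top ?_ (hle.trans ((l2dist_triangle ρ measurable_fst
    (measurable_const (a := x)) measurable_snd).trans (add_le_add_right (l2dist_triangle ρ
      measurable_const (measurable_const (a := y)) measurable_snd) _)))
  rw [l2dist_comm ρ Prod.fst]
  exact ENNReal.add_ne_top.2 ⟨hx, ENNReal.add_ne_top.2 ⟨l2dist_const_ne_top ρ x y, hy⟩⟩

lemma Wdist_comm (μ ν : W2Space Y) : Wdist μ ν = Wdist ν μ := by
  rw [Wdist_eq_toReal, Wdist_eq_toReal, ewdist_comm]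

lemma Wdist_dirac_triangle {δ : W2Space Y} {x : Y} (hδ : δ.1 = Measure.dirac x)
    (μ ν : W2Space Y) : Wdist δ ν ≤ Wdist δ μ + Wdist μ ν := by
  have := μ.2.1
  have := ν.2.1
  simp only [Wdist_eq_toReal]
  rw [← ENNReal.toReal_add (ewdist_ne_top _ _) (ewdist_ne_top _ _)]
  refine ENNReal.toReal_mono (ENNReal.add_ne_top.2 ⟨ewdist_ne_top _ _, ewdist_ne_top _ _⟩) ?_
  rw [hδ]
  exact ewdist_dirac_triangle x μ.1 ν.1

end ewdist

/-- **Statement 16.** In a locally compact, geodesically complete geodesic Polish space `Y`,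
any geodesic segment of `W₂(Y)` issued from a Dirac mass extends to a complete geodesic ray
of the same speed. -/
theorem extend_segment_from_dirac
    (Y : Type*) [MetricSpace Y] [MeasurableSpace Y] [BorelSpace Y]
    [CompleteSpace Y] [TopologicalSpace.SeparableSpace Y] [LocallyCompactSpace Y]
    (hgeo : IsGeodesicSpace Y) (hgc : GeodesicallyComplete Y)
    (T v : ℝ) (hT : 0 < T) (f : ℝ → W2Space Y) (x : Y)
    (hf0 : (f 0).1 = Measure.dirac x)
    (hf : IsGeodesicOnWith Wdist f (Set.Icc 0 T) v) :
    ∃ g : ℝ → W2Space Y, IsGeodesicOnWith Wdist g (Set.Ici 0) v ∧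
      ∀ t ∈ Set.Icc (0:ℝ) T, g t = f t := by
  have := hgeo.properSpace
  obtain ⟨φ, hφm, hφ0, hφ1, hφ⟩ := exists_measurable_rays hgeo hgc x
  have hφ1' : φ 1 = id := funext hφ1
  have hprob := (f T).2.1
  have hm : ewdist (f 0).1 (f T).1 = l2dist (f T).1 (fun _ => x) id := by
    rw [hf0, ewdist_dirac]
  have hmtop : l2dist (f T).1 (fun _ => x) id ≠ ⊤ := hm ▸ ewdist_ne_top _ _
  have hmv : (l2dist (f T).1 (fun _ => x) id).toReal = v * T := by
    rw [← hm, ← Wdist_eq_toReal, hf 0 ⟨le_rfl, hT.le⟩ T ⟨hT.le, le_rfl⟩, zero_sub, abs_neg,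
      abs_of_pos hT]
  have hl2 : ∀ s t, 0 ≤ s → 0 ≤ t → l2dist (f T).1 (φ (s / T)) (φ (t / T)) =
      l2dist (f T).1 (fun _ => x) id * ENNReal.ofReal |s / T - t / T| := fun s t hs ht =>
    l2dist_eq_mul _ fun y => hφ _ _ (by positivity) (by positivity) y
  have hl2top : ∀ s t, 0 ≤ s → 0 ≤ t → l2dist (f T).1 (φ (s / T)) (φ (t / T)) ≠ ⊤ :=
    fun s t hs ht => hl2 s t hs ht ▸ ENNReal.mul_ne_top hmtop ENNReal.ofReal_ne_top
  have hl2real : ∀ s t, 0 ≤ s → 0 ≤ t →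
      (l2dist (f T).1 (φ (s / T)) (φ (t / T))).toReal = v * |s - t| := fun s t hs ht => by
    rw [hl2 s t hs ht, ENNReal.toReal_mul, hmv, ENNReal.toReal_ofReal (abs_nonneg _), ← sub_div,
      abs_div, abs_of_pos hT]
    field_simp
  have hφ0' : φ (0 / T) = fun _ => x := by rw [zero_div]; exact funext hφ0
  have hmem : ∀ t, T ≤ t → IsProbabilityMeasure ((f T).1.map (φ (t / T))) ∧
      ∃ x₀ : Y, (∫⁻ y, ENNReal.ofReal (dist x₀ y) ^ 2 ∂((f T).1.map (φ (t / T)))) < ⊤ := by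
    intro t ht
    have ht0 : 0 ≤ t := hT.le.trans ht
    have hmt := hφm (t / T) (by positivity)
    refine ⟨Measure.isProbabilityMeasure_map hmt.aemeasurable, x, ?_⟩
    have h : l2dist ((f T).1.map (φ (t / T))) (fun _ => x) id ≠ ⊤ := by
      rw [l2dist_map hmt measurable_const measurable_id]
      exact hφ0' ▸ hl2top 0 t le_rfl ht0
    exact (ENNReal.rpow_lt_top_iff_of_pos (by norm_num)).1 h.lt_top
  set g : ℝ → W2Space Y := fun t =>
    if h : t < T then f t else ⟨(f T).1.map (φ (t / T)), hmem t (not_lt.1 h)⟩ with hg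
  have hg1 : ∀ t, T ≤ t → (g t).1 = (f T).1.map (φ (t / T)) := fun t ht => by
    simp [hg, not_lt.2 ht]
  have hg2 : ∀ t ≤ T, g t = f t := fun t ht => by
    rcases ht.lt_or_eq with h | rfl
    · simp [hg, h]
    · refine Subtype.ext ?_
      rw [hg1 _ le_rfl, div_self hT.ne', hφ1', Measure.map_id]
  have hdirac : ∀ t, 0 ≤ t → Wdist (f 0) (g t) = v * t := by
    intro t ht
    rcases le_total t T with h | h
    · rw [hg2 t h, hf 0 ⟨le_rfl, hT.le⟩ t ⟨ht, h⟩, zero_sub, abs_neg, abs_of_nonneg ht]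
    · have := (g t).2.1
      have hmt := hφm (t / T) (by positivity)
      rw [Wdist_eq_toReal, hf0, ewdist_dirac, hg1 t h, l2dist_map hmt measurable_const measurable_id]
      have := hl2real 0 t le_rfl ht
      rw [hφ0', zero_sub, abs_neg, abs_of_nonneg ht] at this
      exact this
  have hupper : ∀ s t, 0 ≤ s → s ≤ t → Wdist (g s) (g t) ≤ v * (t - s) := by
    intro s t hs hst
    have habs : |s - t| = t - s := by rw [abs_sub_comm, abs_of_nonneg (sub_nonneg.2 hst)]
    rcases le_total t T with htT | htT
    · rw [hg2 s (hst.trans htT), hg2 t htT, hf s ⟨hs, hst.trans htT⟩ t ⟨hs.trans hst, htT⟩, habs]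
    have hmt := hφm (t / T) (div_nonneg (hs.trans hst) hT.le)
    rcases le_total T s with hsT | hsT
    · rw [← habs, ← hl2real s t hs (hs.trans hst), Wdist_eq_toReal, hg1 s hsT, hg1 t htT]
      exact ENNReal.toReal_mono (hl2top s t hs (hs.trans hst))
        (ewdist_map_le _ (hφm (s / T) (by positivity)) hmt)
    · have htop := hl2top T t hT.le (hs.trans hst)
      have hreal := hl2real T t hT.le (hs.trans hst)
      rw [div_self hT.ne', hφ1'] at htop hreal
      have h1 := hf s ⟨hs, hsT⟩ T ⟨hT.le, le_rfl⟩
      have h2 := ENNReal.toReal_mono (ENNReal.add_ne_top.2 ⟨ewdist_ne_top (f s) (f T), htop⟩)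
        (ewdist_map_triangle (f s).1 (f T).1 hmt)
      rw [ENNReal.toReal_add (ewdist_ne_top _ _) htop, ← Wdist_eq_toReal, h1, hreal, ← hg1 t htT,
        ← hg2 s hsT, ← Wdist_eq_toReal, abs_of_nonpos (sub_nonpos.2 hsT),
        abs_of_nonpos (sub_nonpos.2 htT)] at h2
      linarith
  have hle : ∀ s t, 0 ≤ s → s ≤ t → Wdist (g s) (g t) = v * (t - s) := by
    intro s t hs hst
    refine le_antisymm (hupper s t hs hst) ?_
    have := Wdist_dirac_triangle hf0 (g s) (g t)
    rw [hdirac s hs, hdirac t (hs.trans hst)] at this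
    linarith
  refine ⟨g, fun s hs t ht => ?_, fun t ht => hg2 t ht.2⟩
  rcases le_total s t with h | h
  · rw [hle s t hs h, abs_sub_comm, abs_of_nonneg (sub_nonneg.2 h)]
  · rw [Wdist_comm, hle t s ht h, abs_of_nonneg (sub_nonneg.2 h)]

end
end
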